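/- Disjunction Property of intuitionistic propositional logic: for all formulas φ, ψ, if ⊢_i φ ∨ ψ (φ ∨ ψ is derivable from the empty premiss set in intuitionistic propositional logic), then ⊢_i φ or ⊢_i ψ. -/

import Mathlib

/-- The four propositional connectives. -/
inductive Conn : Type
  | conj | disj | impl | nega
deriving DecidableEq

/-- Propositional formulas over countably many letters `p₀, p₁, …`. -/
inductive PropForm : Type
  | var : ℕ → PropForm
  | and : PropForm → PropForm → PropForm
  | or : PropForm → PropForm → PropForm
  | imp : PropForm → PropForm → PropForm
  | neg : PropForm → PropForm

/-- The set of connectives occurring in a formula. -/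
def PropForm.conns : PropForm → Set Conn
  | .var _ => ∅
  | .and a b => insert .conj (a.conns ∪ b.conns)
  | .or a b => insert .disj (a.conns ∪ b.conns)
  | .imp a b => insert .impl (a.conns ∪ b.conns)
  | .neg a => insert .nega a.conns

/-- `φ ∈ 𝔉_F` : the formula `φ` uses only connectives belonging to the fragment `F`. -/
def InFrag (F : Set Conn) (φ : PropForm) : Prop := φ.conns ⊆ F

/-- Derivability `Γ ⊢_F φ` for the fragment `F`: the least relation closed under
membership, monotonicity, cut, and the two directions of the rules
(R∧), (R∨), (R→), (R¬I), (R¬E) for the connectives in `F`. -/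
inductive Deriv (F : Set Conn) : Set PropForm → PropForm → Prop
  | mem {Γ : Set PropForm} {φ : PropForm} : φ ∈ Γ → Deriv F Γ φ
  | mono {Γ : Set PropForm} {φ ψ : PropForm} : Deriv F Γ φ → Deriv F (insert ψ Γ) φ
  | cut {Γ Δ : Set PropForm} {φ ψ : PropForm} :
      Deriv F Γ φ → Deriv F (insert φ Δ) ψ → Deriv F (Γ ∪ Δ) ψ
  | andI {Γ : Set PropForm} {φ ψ : PropForm} :
      Conn.conj ∈ F → Deriv F Γ φ → Deriv F Γ ψ → Deriv F Γ (.and φ ψ)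
  | andE1 {Γ : Set PropForm} {φ ψ : PropForm} :
      Conn.conj ∈ F → Deriv F Γ (.and φ ψ) → Deriv F Γ φ
  | andE2 {Γ : Set PropForm} {φ ψ : PropForm} :
      Conn.conj ∈ F → Deriv F Γ (.and φ ψ) → Deriv F Γ ψ
  | orI {Γ : Set PropForm} {φ ψ χ : PropForm} :
      Conn.disj ∈ F → Deriv F (insert φ Γ) χ → Deriv F (insert ψ Γ) χ →
      Deriv F (insert (.or φ ψ) Γ) χ
  | orE1 {Γ : Set PropForm} {φ ψ χ : PropForm} :
      Conn.disj ∈ F → Deriv F (insert (.or φ ψ) Γ) χ → Deriv F (insert φ Γ) χ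
  | orE2 {Γ : Set PropForm} {φ ψ χ : PropForm} :
      Conn.disj ∈ F → Deriv F (insert (.or φ ψ) Γ) χ → Deriv F (insert ψ Γ) χ
  | impI {Γ : Set PropForm} {φ ψ : PropForm} :
      Conn.impl ∈ F → Deriv F (insert φ Γ) ψ → Deriv F Γ (.imp φ ψ)
  | impE {Γ : Set PropForm} {φ ψ : PropForm} :
      Conn.impl ∈ F → Deriv F Γ (.imp φ ψ) → Deriv F (insert φ Γ) ψ
  | negI {Γ : Set PropForm} {φ ψ : PropForm} :
      Conn.nega ∈ F → Deriv F (insert φ Γ) ψ → Deriv F (insert φ Γ) (.neg ψ) →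
      Deriv F Γ (.neg φ)
  | negE {Γ : Set PropForm} {φ ψ : PropForm} :
      Conn.nega ∈ F → Deriv F Γ φ → Deriv F Γ (.neg φ) → Deriv F Γ ψ

/-- An algebra interpreting the connectives on a carrier `V`. -/
structure Alg (V : Type) where
  and : V → V → V
  or : V → V → V
  imp : V → V → V
  neg : V → V

/-- The homomorphic extension of an assignment `v` of letters. -/
def Alg.eval {V : Type} (A : Alg V) (v : ℕ → V) : PropForm → V
  | .var n => v n
  | .and a b => A.and (A.eval v a) (A.eval v b)
  | .or a b => A.or (A.eval v a) (A.eval v b)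
  | .imp a b => A.imp (A.eval v a) (A.eval v b)
  | .neg a => A.neg (A.eval v a)

/-- Semantic consequence `Γ ⊨_{A,D} φ`. -/
def SemConseq {V : Type} (A : Alg V) (D : Set V) (Γ : Set PropForm) (φ : PropForm) : Prop :=
  ∀ v : ℕ → V, (∀ ψ ∈ Γ, A.eval v ψ ∈ D) → A.eval v φ ∈ D

/-- The fragment `F` has a finite semantics. -/
def HasFiniteSemantics (F : Set Conn) : Prop :=
  ∃ (V : Type) (_ : Fintype V) (A : Alg V) (D : Set V),
    ∀ (Γ : Set PropForm) (φ : PropForm),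
      (∀ ψ ∈ Γ, InFrag F ψ) → InFrag F φ →
      (Deriv F Γ φ ↔ SemConseq A D Γ φ)

/-- `φ ∨̇ ψ = (φ → ψ) → ψ`. -/
def dvee (a b : PropForm) : PropForm := .imp (.imp a b) b

/-- Left-associated iterated `∨̇` of a list of formulas. -/
def bigDvee : List PropForm → PropForm
  | [] => .var 0
  | a :: rest => rest.foldl dvee a

/-- Left-associated iterated `∨` of a list of formulas. -/
def bigOrF : List PropForm → PropForm
  | [] => .var 0
  | a :: rest => rest.foldl PropForm.or a

/-- All pairs `(i, j)` with `1 ≤ i < j ≤ n+1`. -/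
def pairs (n : ℕ) : List (ℕ × ℕ) :=
  (List.range' 2 n).flatMap fun j => (List.range' 1 (j - 1)).map fun i => (i, j)

/-- `α_n = ∨̇_{1 ≤ i < j ≤ n+1} (p_j → p_i)`. -/
def alphaImp (n : ℕ) : PropForm :=
  bigDvee ((pairs n).map fun p => .imp (.var p.2) (.var p.1))

/-- `α_n = ⋁_{1 ≤ i < j ≤ n+1} ¬¬(¬p_i ∨ p_j)`. -/
def alphaOrNeg (n : ℕ) : PropForm :=
  bigOrF ((pairs n).map fun p => .neg (.neg (.or (.neg (.var p.1)) (.var p.2))))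

/-- Two-valued Boolean evaluation. -/
def evalBool (v : ℕ → Bool) : PropForm → Bool
  | .var n => v n
  | .and a b => evalBool v a && evalBool v b
  | .or a b => evalBool v a || evalBool v b
  | .imp a b => !evalBool v a || evalBool v b
  | .neg a => !evalBool v a

/-- Classical (two-valued) consequence `Γ ⊢_c φ`. -/
def ClassConseq (Γ : Set PropForm) (φ : PropForm) : Prop :=
  ∀ v : ℕ → Bool, (∀ ψ ∈ Γ, evalBool v ψ = true) → evalBool v φ = true

/-- The two-element Boolean algebra `𝟐`. -/
def alg2 : Alg Bool where
  and a b := a && b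
  or a b := a || b
  imp a b := !a || b
  neg a := !a

/-- The three-element algebra `𝟑` on the chain `0 < 1/2 < 1` (coded as `0 < 1 < 2` in `Fin 3`),
with meet `min` and meet complement `¬0 = 1`, `¬(1/2) = ¬1 = 0` (its `or`/`imp` are those of the
3-element Heyting chain). -/
def alg3 : Alg (Fin 3) where
  and a b := min a b
  or a b := max a b
  imp a b := if a ≤ b then 2 else b
  neg a := if a = 0 then 2 else 0

/-- The `(n+1)`-element Heyting chain, coded on `Fin (n+1)` (so `k` codes the element `k+1`). -/
def chainAlg (n : ℕ) : Alg (Fin (n + 1)) where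
  and a b := min a b
  or a b := max a b
  imp a b := if a ≤ b then Fin.last n else b
  neg a := if a = 0 then Fin.last n else 0

/-- Cut with shared premisses. -/
theorem Deriv.cut_same {F : Set Conn} {Γ : Set PropForm} {φ ψ : PropForm}
    (h : Deriv F Γ φ) (h' : Deriv F (insert φ Γ) ψ) : Deriv F Γ ψ := by
  simpa using Deriv.cut h h'

theorem Deriv.or_inl {F : Set Conn} {Γ : Set PropForm} {φ ψ : PropForm}
    (hF : Conn.disj ∈ F) (h : Deriv F Γ φ) : Deriv F Γ (.or φ ψ) :=
  h.cut_same (.orE1 hF (.mem (Set.mem_insert (PropForm.or φ ψ) Γ)))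

theorem Deriv.or_inr {F : Set Conn} {Γ : Set PropForm} {φ ψ : PropForm}
    (hF : Conn.disj ∈ F) (h : Deriv F Γ ψ) : Deriv F Γ (.or φ ψ) :=
  h.cut_same (.orE2 hF (.mem (Set.mem_insert (PropForm.or φ ψ) Γ)))

theorem Deriv.forall_mem_insert {F : Set Conn} {Γ Δ : Set PropForm} (φ : PropForm)
    (h : ∀ γ ∈ Γ, Deriv F Δ γ) : ∀ γ ∈ insert φ Γ, Deriv F (insert φ Δ) γ :=
  Set.forall_mem_insert.2 ⟨.mem (Set.mem_insert φ Δ), fun γ hγ => .mono (h γ hγ)⟩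

/-- Simultaneous cut of a possibly infinite set of premisses. -/
theorem Deriv.cut_set {F : Set Conn} {Γ Δ : Set PropForm} {φ : PropForm}
    (h : Deriv F Γ φ) (hΓ : ∀ γ ∈ Γ, Deriv F Δ γ) : Deriv F Δ φ := by
  induction h generalizing Δ with
  | mem hφ => exact hΓ _ hφ
  | mono _ ih => exact ih (Set.forall_mem_insert.1 hΓ).2
  | cut _ _ ih₁ ih₂ =>
    exact ih₂ (Set.forall_mem_insert.2
      ⟨ih₁ fun γ hγ => hΓ γ (.inl hγ), fun γ hγ => hΓ γ (.inr hγ)⟩)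
  | andI hF _ _ ih₁ ih₂ => exact .andI hF (ih₁ hΓ) (ih₂ hΓ)
  | andE1 hF _ ih => exact .andE1 hF (ih hΓ)
  | andE2 hF _ ih => exact .andE2 hF (ih hΓ)
  | orI hF _ _ ih₁ ih₂ =>
    obtain ⟨hor, hΓ⟩ := Set.forall_mem_insert.1 hΓ
    exact hor.cut_same
      (.orI hF (ih₁ (forall_mem_insert _ hΓ)) (ih₂ (forall_mem_insert _ hΓ)))
  | orE1 hF _ ih =>
    obtain ⟨hφ, hΓ⟩ := Set.forall_mem_insert.1 hΓ
    exact ih (Set.forall_mem_insert.2 ⟨hφ.or_inl hF, hΓ⟩)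
  | orE2 hF _ ih =>
    obtain ⟨hφ, hΓ⟩ := Set.forall_mem_insert.1 hΓ
    exact ih (Set.forall_mem_insert.2 ⟨hφ.or_inr hF, hΓ⟩)
  | impI hF _ ih => exact .impI hF (ih (forall_mem_insert _ hΓ))
  | impE hF _ ih =>
    obtain ⟨hφ, hΓ⟩ := Set.forall_mem_insert.1 hΓ
    exact hφ.cut_same (.impE hF (ih hΓ))
  | negI hF _ _ ih₁ ih₂ =>
    exact .negI hF (ih₁ (forall_mem_insert _ hΓ)) (ih₂ (forall_mem_insert _ hΓ))
  | negE hF _ _ ih₁ ih₂ => exact .negE hF (ih₁ hΓ) (ih₂ hΓ)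

/-- The Aczel slash over the empty premiss set. -/
def PropForm.Slash : PropForm → Prop
  | .var n => Deriv Set.univ ∅ (.var n)
  | .and a b => a.Slash ∧ b.Slash
  | .or a b => a.Slash ∨ b.Slash
  | .imp a b => Deriv Set.univ ∅ (.imp a b) ∧ (a.Slash → b.Slash)
  | .neg a => Deriv Set.univ ∅ (.neg a) ∧ ¬ a.Slash

theorem PropForm.Slash.deriv {φ : PropForm} (h : φ.Slash) : Deriv Set.univ ∅ φ := by
  induction φ with
  | var n => exact h
  | and a b iha ihb => exact .andI trivial (iha h.1) (ihb h.2)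
  | or a b iha ihb =>
    exact h.elim (fun ha => (iha ha).or_inl trivial) fun hb => (ihb hb).or_inr trivial
  | imp a b => exact h.1
  | neg a => exact h.1

/-- Derivability preserves the slash. -/
theorem Deriv.slash {Γ : Set PropForm} {φ : PropForm} (h : Deriv Set.univ Γ φ)
    (hΓ : ∀ γ ∈ Γ, γ.Slash) : φ.Slash := by
  induction h with
  | mem hφ => exact hΓ _ hφ
  | mono _ ih => exact ih (Set.forall_mem_insert.1 hΓ).2
  | cut _ _ ih₁ ih₂ =>
    exact ih₂ (Set.forall_mem_insert.2
      ⟨ih₁ fun γ hγ => hΓ γ (.inl hγ), fun γ hγ => hΓ γ (.inr hγ)⟩)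
  | andI _ _ _ ih₁ ih₂ => exact ⟨ih₁ hΓ, ih₂ hΓ⟩
  | andE1 _ _ ih => exact (ih hΓ).1
  | andE2 _ _ ih => exact (ih hΓ).2
  | orI _ _ _ ih₁ ih₂ =>
    obtain ⟨hor, hΓ⟩ := Set.forall_mem_insert.1 hΓ
    exact hor.elim (fun ha => ih₁ (Set.forall_mem_insert.2 ⟨ha, hΓ⟩))
      fun hb => ih₂ (Set.forall_mem_insert.2 ⟨hb, hΓ⟩)
  | orE1 _ _ ih =>
    obtain ⟨hφ, hΓ⟩ := Set.forall_mem_insert.1 hΓ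
    exact ih (Set.forall_mem_insert.2 ⟨.inl hφ, hΓ⟩)
  | orE2 _ _ ih =>
    obtain ⟨hφ, hΓ⟩ := Set.forall_mem_insert.1 hΓ
    exact ih (Set.forall_mem_insert.2 ⟨.inr hφ, hΓ⟩)
  | impI hF h ih =>
    exact ⟨(Deriv.impI hF h).cut_set fun γ hγ => (hΓ γ hγ).deriv,
      fun ha => ih (Set.forall_mem_insert.2 ⟨ha, hΓ⟩)⟩
  | impE _ _ ih =>
    obtain ⟨hφ, hΓ⟩ := Set.forall_mem_insert.1 hΓ
    exact (ih hΓ).2 hφ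
  | negI hF h₁ h₂ ih₁ ih₂ =>
    refine ⟨(Deriv.negI hF h₁ h₂).cut_set fun γ hγ => (hΓ γ hγ).deriv, fun ha => ?_⟩
    have hΓ' := Set.forall_mem_insert.2 ⟨ha, hΓ⟩
    exact (ih₂ hΓ').2 (ih₁ hΓ')
  | negE _ _ _ ih₁ ih₂ => exact absurd (ih₁ hΓ) (ih₂ hΓ).2

/-- Disjunction Property: if `⊢_i φ ∨ ψ` then `⊢_i φ` or `⊢_i ψ`. -/
theorem disjunction_property (φ ψ : PropForm)
    (h : Deriv (Set.univ : Set Conn) ∅ (.or φ ψ)) :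
    Deriv (Set.univ : Set Conn) ∅ φ ∨ Deriv (Set.univ : Set Conn) ∅ ψ :=
  (h.slash fun _ hγ => hγ.elim).imp PropForm.Slash.deriv PropForm.Slash.deriv
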